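/- A PO system is a set $P$ with a transitive antisymmetric relation $<$ (not necessarily irreflexive); write $p\leqslant q$ for "$p<q$ or $p=q$", and $P^d=\{p\in P\mid p\nless p\}$. A morphism of PO systems is a map $\alpha\colon Q\to P$ such that for each $q\in Q$ the image under $\alpha$ of $\{r\in Q\mid r>q\}$ is $\{p\in P\mid p>\alpha(q)\}$; an isomorphism is a bijection preserving and reflecting $<$; and $P$ is simple if every morphism from $P$ to a PO system is injective. An $\omega$-Stone space $W$ is a second countable, locally compact, Hausdorff, totally disconnected space; $\mathrm{Co}(W)$ denotes the Boolean ring of its compact open subsets, $(A)=\{C\in \mathrm{Co}(W)\mid C\subseteq A\}$ for $A\in\mathrm{Co}(W)$, and $S'$ denotes the derived set of $S\subseteq W$. A $P$-partition of $W$ is a family $\{Y_p\mid p\in P\}$ of pairwise disjoint nonempty subsets of $W$ with union $Y$ such that $Y_p'\cap Y=\bigcup_{q<p}Y_q$ for all $p\in P$. A compact open set $A$ is $p$-trim if $\{q\in P\mid A\cap Y_q\neq\emptyset\}=\{q\mid q\geqslant p\}$ and, when $p\in P^d$, also $|A\cap Y_p|=1$; it is trim if it is $p$-trim for some $p\in P$.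 The $P$-partition is trim if (T1) every point of $W$ has a neighbourhood base of trim sets; (T2) for each $p$ for which a $p$-trim set exists, every point of $W$ with a neighbourhood base of $p$-trim sets lies in $Y_p$; and (T3) for every $p\in P$, every point of $Y_p$ has a $p$-trim neighbourhood. A nonempty $A\in\mathrm{Co}(W)$ is pseudo-indecomposable (PI) if for every $B\in\mathrm{Co}(W)$ with $B\subseteq A$ either $(B)\cong(A)$ or $(A\setminus B)\cong(A)$ as Boolean rings; $W$ is primitive if every element of $\mathrm{Co}(W)$ is a disjoint union of finitely many PI sets. The structure diagram $\mathscr{S}(W)$ is the PO system of isomorphism classes $[A]$ of the ideals $(A)$, $A$ a PI set, with $[A]<[B]$ iff $(A)\times(B)\cong(A)$. The canonical partition of $W$ is $\mathscr{X}(W)=\{X_s\mid s\in\mathscr{S}(W)\}$, where $X_s$ is the set of points of $W$ having a neighbourhood base of compact open sets belonging to the class $s$. Theorem. Let $P$ be a countable PO system and $\mathscr{Y}=\{Y_p\mid p\in P\}$ a trim $P$-partition of the $\omega$-Stone space $W$. Then $W$ is primitive, and the following are equivalent: (1) $\mathscr{Y}$ equals the canonical partition $\mathscr{X}(W)$ after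 relabelling, i.e. there is an isomorphism $\theta\colon P\to\mathscr{S}(W)$ of PO systems with $Y_p=X_{\theta(p)}$ for all $p\in P$; (2) $P$ is isomorphic to $\mathscr{S}(W)$; (3) $P$ is simple. -/

import Mathlib

open Set Topology TopologicalSpace

universe u v

/-- A PO system: a set with a transitive antisymmetric relation `<` (not assumed irreflexive). -/
class POSystem (P : Type u) extends LT P where
  trans' : ∀ {a b c : P}, a < b → b < c → a < c
  antisymm' : ∀ {a b : P}, a < b → b < a → a = b

/-- `p ≤ q` in a PO system: `p < q` or `p = q`. -/
def POSystem.Le {P : Type u} [POSystem P] (p q : P) : Prop := p < q ∨ p = q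

/-- The subset `P^d = {p | ¬ p < p}`. -/
def POSystem.discretePart (P : Type u) [POSystem P] : Set P := {p | ¬ p < p}

/-- A morphism of PO systems: the image of `{r | r > q}` is `{p | p > α q}`. -/
def IsPOMorphism {Q : Type u} {P : Type v} [POSystem Q] [POSystem P] (α : Q → P) : Prop :=
  ∀ q : Q, α '' {r | q < r} = {p | α q < p}

/-- Isomorphisms of PO systems: bijections preserving and reflecting `<`. -/
abbrev POIso (P : Type u) (Q : Type v) [POSystem P] [POSystem Q] :=
  ((· < ·) : P → P → Prop) ≃r ((· < ·) : Q → Q → Prop)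

/-- A PO system is simple if every morphism from it to a PO system is injective. Targets in the
universe of `P` suffice, since a morphism may be corestricted to its image. -/
def POSystem.IsSimple (P : Type u) [POSystem P] : Prop :=
  ∀ (R : Type u) [POSystem R] (α : P → R), IsPOMorphism α → Function.Injective α

section TrimPartitions

variable {W : Type u} [TopologicalSpace W] {P : Type v}

/-- The type `T(S)` of a subset `S` of `W` with respect to the family `X`. -/
def partType (X : P → Set W) (S : Set W) : Set P := {p | (S ∩ X p).Nonempty}

variable [POSystem P]

/-- `X` is a `P`-partition: the blocks are nonempty and pairwise disjoint, and the derived set of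
`X p` meets the union of all blocks in `⋃_{q < p} X q`. -/
structure IsPPartition (X : P → Set W) : Prop where
  nonempty : ∀ p, (X p).Nonempty
  disjoint : Pairwise fun p q => Disjoint (X p) (X q)
  derived : ∀ p, derivedSet (X p) ∩ (⋃ q, X q) = ⋃ q ∈ {q : P | q < p}, X q

/-- The compact open set `A` is `p`-trim. -/
def IsTrimAt (X : P → Set W) (A : CompactOpens W) (p : P) : Prop :=
  partType X A = {q | POSystem.Le p q} ∧
    (p ∈ POSystem.discretePart P → ((A : Set W) ∩ X p).encard = 1)

/-- The compact open set `A` is trim. -/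
def IsTrim (X : P → Set W) (A : CompactOpens W) : Prop := ∃ p, IsTrimAt X A p

/-- The set `P̂` of all `p` for which some compact open set is `p`-trim. -/
def trimTypes (X : P → Set W) : Set P := {p | ∃ A : CompactOpens W, IsTrimAt X A p}

/-- A trim `P`-partition. -/
structure IsTrimPartition (X : P → Set W) : Prop extends IsPPartition X where
  /-- (T1) Every point of `W` has a neighbourhood base of trim sets. -/
  base : ∀ w : W, ∀ U ∈ 𝓝 w, ∃ A : CompactOpens W, IsTrim X A ∧ w ∈ A ∧ (A : Set W) ⊆ U
  /-- (T2) For `p ∈ P̂`, a point with a neighbourhood base of `p`-trim sets lies in `X p`. -/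
  full : ∀ p ∈ trimTypes X, ∀ w : W,
    (∀ U ∈ 𝓝 w, ∃ A : CompactOpens W, IsTrimAt X A p ∧ w ∈ A ∧ (A : Set W) ⊆ U) → w ∈ X p
  /-- (T3) Every point of every block `X p` has a `p`-trim neighbourhood. -/
  clean : ∀ p, ∀ w ∈ X p, ∃ A : CompactOpens W, IsTrimAt X A p ∧ w ∈ A

end TrimPartitions

section BooleanRings

/-! Boolean rings (possibly without `1`) are treated as generalized Boolean algebras. The ideal
`(A)` is `Set.Iic A`; ring isomorphisms between Boolean rings are the same as order isomorphisms,
and a product of Boolean rings carries the product order. -/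

/-- `A` is pseudo-indecomposable: `A` is nonzero and, for every `B ≤ A`, `(B) ≅ (A)` or
`(A - B) ≅ (A)`. -/
def IsPI {R : Type u} [GeneralizedBooleanAlgebra R] (A : R) : Prop :=
  A ≠ ⊥ ∧ ∀ B ≤ A, Nonempty (Iic B ≃o Iic A) ∨ Nonempty (Iic (A \ B) ≃o Iic A)

/-- `R` is primitive: every element is a disjoint union of finitely many PI elements. -/
def IsPrimitiveRing (R : Type u) [GeneralizedBooleanAlgebra R] : Prop :=
  ∀ A : R, ∃ F : Finset R,
    (∀ B ∈ F, IsPI B) ∧ (F : Set R).PairwiseDisjoint id ∧ F.sup id = A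

/-- PI elements `A`, `B` are equivalent iff `(A) ≅ (B)`. -/
def isoClassSetoid (R : Type u) [GeneralizedBooleanAlgebra R] : Setoid {A : R // IsPI A} where
  r A B := Nonempty (Iic A.1 ≃o Iic B.1)
  iseqv := ⟨fun _ => ⟨OrderIso.refl _⟩, fun ⟨e⟩ => ⟨e.symm⟩, fun ⟨e⟩ ⟨f⟩ => ⟨e.trans f⟩⟩

/-- The elements of the structure diagram: isomorphism classes `[A]` of ideals `(A)`, `A` PI. -/
def StructureDiagram (R : Type u) [GeneralizedBooleanAlgebra R] : Type u :=
  Quotient (isoClassSetoid R)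

/-- The class `[A]` of a PI element `A`. -/
def piClass {R : Type u} [GeneralizedBooleanAlgebra R] (A : {A : R // IsPI A}) :
    StructureDiagram R :=
  Quotient.mk (isoClassSetoid R) A

/-- The product of two order isomorphisms. -/
def orderIsoProd {α β γ δ : Type*} [LE α] [LE β] [LE γ] [LE δ] (e : α ≃o γ) (f : β ≃o δ) :
    α × β ≃o γ × δ where
  toEquiv := e.toEquiv.prodCongr f.toEquiv
  map_rel_iff' := by
    rintro ⟨a, b⟩ ⟨c, d⟩
    exact and_congr e.map_rel_iff f.map_rel_iff

/-- The relation `[A] < [B]` iff `(A) × (B) ≅ (A)`. -/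
def StructureDiagram.Lt {R : Type u} [GeneralizedBooleanAlgebra R]
    (x y : StructureDiagram R) : Prop :=
  Quotient.liftOn₂ x y
    (fun A B : {A : R // IsPI A} => Nonempty ((Iic A.1 × Iic B.1) ≃o Iic A.1))
    (fun _ _ _ _ ⟨e⟩ ⟨f⟩ => propext
      ⟨fun ⟨g⟩ => ⟨((orderIsoProd e.symm f.symm).trans g).trans e⟩,
        fun ⟨g⟩ => ⟨((orderIsoProd e f).trans g).trans e.symm⟩⟩)

/-- The structure diagram is a PO system. -/
instance StructureDiagram.instPOSystem (R : Type u) [GeneralizedBooleanAlgebra R] :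
    POSystem (StructureDiagram R) where
  lt := StructureDiagram.Lt
  trans' := by
    rintro ⟨A⟩ ⟨B⟩ ⟨C⟩ ⟨e⟩ ⟨f⟩
    exact ⟨(((orderIsoProd e.symm (OrderIso.refl _)).trans (OrderIso.prodAssoc _ _ _)).trans
      (orderIsoProd (OrderIso.refl _) f)).trans e⟩
  antisymm' := by
    rintro ⟨A⟩ ⟨B⟩ ⟨e⟩ ⟨f⟩
    exact Quotient.sound ⟨(e.symm.trans OrderIso.prodComm).trans f⟩

end BooleanRings

/-- The block `X_p` of the canonical partition of `W`: the points of `W` that have a neighbourhood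
base of compact open sets belonging to the class `p`. -/
def canonicalBlock {W : Type u} [TopologicalSpace W] [T2Space W]
    (p : StructureDiagram (CompactOpens W)) : Set W :=
  {w | ∀ U ∈ 𝓝 w, ∃ A : {A : CompactOpens W // IsPI A},
    piClass A = p ∧ w ∈ A.1 ∧ (A.1 : Set W) ⊆ U}

section IdealIsomorphisms

variable {α : Type*} [GeneralizedBooleanAlgebra α]

/-- For disjoint `a` and `b`, the ideal `(a ⊔ b)` is the product of `(a)` and `(b)`. -/
def iicProdIicOrderIso {a b : α} (h : Disjoint a b) : Iic a × Iic b ≃o Iic (a ⊔ b) where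
  toFun x := ⟨x.1.1 ⊔ x.2.1, sup_le_sup x.1.2 x.2.2⟩
  invFun y := (⟨a ⊓ y.1, inf_le_left⟩, ⟨b ⊓ y.1, inf_le_left⟩)
  left_inv := by
    rintro ⟨⟨x, hx⟩, ⟨y, hy⟩⟩
    have hx : x ≤ a := hx
    have hy : y ≤ b := hy
    ext
    · simp [inf_sup_left, inf_eq_right.2 hx, (h.mono_right hy).eq_bot]
    · simp [inf_sup_left, inf_eq_right.2 hy, (h.symm.mono_right hx).eq_bot]
  right_inv := by
    rintro ⟨y, hy⟩
    ext
    simpa [← inf_sup_right] using hy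
  map_rel_iff' := by
    rintro ⟨⟨x, hx⟩, ⟨y, hy⟩⟩ ⟨⟨x', hx'⟩, ⟨y', hy'⟩⟩
    simp only [Equiv.coe_fn_mk, Subtype.mk_le_mk, Prod.mk_le_mk]
    refine ⟨fun hle => ⟨?_, ?_⟩, fun hle => sup_le_sup hle.1 hle.2⟩
    · exact (h.mono hx hy').left_le_of_le_sup_right (le_sup_left.trans hle)
    · exact (h.symm.mono hy hx').left_le_of_le_sup_left (le_sup_right.trans hle)

/-- The decomposition of `(a)` along `b ≤ a`. -/
def iicSdiffProdIicOrderIso {a b : α} (h : b ≤ a) : Iic (a \ b) × Iic b ≃o Iic a :=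
  (iicProdIicOrderIso disjoint_sdiff_self_left).trans
    (OrderIso.setCongr _ _ (by rw [sdiff_sup_cancel h]))

/-- An isomorphism of ideals restricts to smaller ideals. -/
def OrderIso.iicRestrict {β : Type*} [Preorder β] {γ : Type*} [Preorder γ] {a : β} {b : γ}
    (e : Iic a ≃o Iic b) (x : Iic a) : Iic x.1 ≃o Iic (e x).1 where
  toFun y := ⟨(e ⟨y.1, y.2.trans x.2⟩).1, e.monotone y.2⟩
  invFun z := ⟨(e.symm ⟨z.1, z.2.trans (e x).2⟩).1, by
    have := e.symm.monotone (a := ⟨z.1, z.2.trans (e x).2⟩) (b := e x) z.2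
    simpa using this⟩
  left_inv y := by
    have h := congrArg Subtype.val (e.symm_apply_apply ⟨y.1, y.2.trans x.2⟩)
    exact Subtype.ext h
  right_inv z := by
    have h := congrArg Subtype.val (e.apply_symm_apply ⟨z.1, z.2.trans (e x).2⟩)
    exact Subtype.ext h
  map_rel_iff' := by
    rintro ⟨y, hy⟩ ⟨z, hz⟩
    exact e.map_rel_iff (a := ⟨y, _⟩) (b := ⟨z, _⟩)

theorem OrderIso.iic_map_sdiff {β : Type*} [GeneralizedBooleanAlgebra β] {a : α} {b : β}
    (e : Iic a ≃o Iic b) (x : Iic a) :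
    (e ⟨a \ x.1, sdiff_le⟩).1 = b \ (e x).1 := by
  have hd : Disjoint (e ⟨a \ x.1, sdiff_le⟩).1 (e x).1 := by
    rw [disjoint_iff_inf_le]
    have hm : ∀ y : Iic b, y.1 ≤ (e ⟨a \ x.1, sdiff_le⟩).1 → y.1 ≤ (e x).1 → y.1 ≤ ⊥ := by
      intro y h1 h2
      have h1' : (e.symm y).1 ≤ a \ x.1 := (e.symm_apply_le (y := y)).2 h1
      have h2' : (e.symm y).1 ≤ x.1 := (e.symm_apply_le (y := y)).2 h2
      have h3 : (e.symm y).1 = ⊥ := le_bot_iff.1 (disjoint_sdiff_self_left h1' h2')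
      have h4 : e.symm y ≤ e.symm ⟨⊥, bot_le⟩ := by
        rw [← Subtype.coe_le_coe, h3]
        exact bot_le
      exact e.symm.le_iff_le.1 h4
    exact hm ⟨_, inf_le_left.trans (e ⟨a \ x.1, sdiff_le⟩).2⟩ inf_le_left inf_le_right
  have hs : b ≤ (e ⟨a \ x.1, sdiff_le⟩).1 ⊔ (e x).1 := by
    have hm : ∀ y : Iic b, (e ⟨a \ x.1, sdiff_le⟩).1 ≤ y.1 → (e x).1 ≤ y.1 → b ≤ y.1 := by
      intro y h1 h2
      have h1' : a \ x.1 ≤ (e.symm y).1 := (e.le_symm_apply (y := y)).2 h1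
      have h2' : x.1 ≤ (e.symm y).1 := (e.le_symm_apply (y := y)).2 h2
      have h3 : a ≤ (e.symm y).1 :=
        (sdiff_sup_cancel (show x.1 ≤ a from x.2)).ge.trans (sup_le h1' h2')
      have h4 : e.symm ⟨b, le_rfl⟩ ≤ e.symm y := (show (e.symm ⟨b, le_rfl⟩).1 ≤ a from
        (e.symm ⟨b, le_rfl⟩).2).trans h3
      exact e.symm.le_iff_le.1 h4
    exact hm ⟨_, sup_le (e ⟨a \ x.1, sdiff_le⟩).2 (e x).2⟩ le_sup_left le_sup_right
  apply le_antisymm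
  · exact le_sdiff.2 ⟨(e ⟨a \ x.1, sdiff_le⟩).2, hd⟩
  · rw [sdiff_le_iff, sup_comm]
    exact hs

/-- Pseudo-indecomposability depends only on the isomorphism class of the ideal. -/
theorem IsPI.of_orderIso {a b : α} (ha : IsPI a) (e : Iic a ≃o Iic b) : IsPI b := by
  refine ⟨fun hb => ha.1 ?_, fun c hc => ?_⟩
  · have h : e ⟨a, le_rfl⟩ ≤ e ⟨⊥, bot_le⟩ := by
      rw [← Subtype.coe_le_coe]
      exact le_trans (e ⟨a, le_rfl⟩).2 (hb.le.trans bot_le)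
    exact le_bot_iff.1 (e.le_iff_le.1 h)
  · have hx : e (e.symm ⟨c, hc⟩) = ⟨c, hc⟩ := e.apply_symm_apply _
    have h1 := e.iicRestrict (e.symm ⟨c, hc⟩)
    have h2 := e.iicRestrict ⟨a \ (e.symm ⟨c, hc⟩).1, sdiff_le⟩
    rw [hx] at h1
    rw [e.iic_map_sdiff, hx] at h2
    rcases ha.2 _ (e.symm ⟨c, hc⟩).2 with ⟨⟨f⟩⟩ | ⟨⟨f⟩⟩
    · exact Or.inl ⟨(h1.symm.trans f).trans e⟩
    · exact Or.inr ⟨(h2.symm.trans f).trans e⟩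

end IdealIsomorphisms

section BackAndForth

/-- A relation between partial orders that is total on both sides and matches the
orders yields an order isomorphism. -/
theorem nonempty_orderIso_of_rel {β γ : Type*} [PartialOrder β] [PartialOrder γ]
    (r : β → γ → Prop) (hl : ∀ x, ∃ y, r x y) (hr : ∀ y, ∃ x, r x y)
    (h : ∀ x y x' y', r x y → r x' y' → (x ≤ x' ↔ y ≤ y')) : Nonempty (β ≃o γ) := by
  choose f hf using hl
  choose g hg using hr
  refine ⟨⟨⟨f, g, fun x => ?_, fun y => ?_⟩, fun {a b} => (h _ _ _ _ (hf a) (hf b)).symm⟩⟩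
  · exact le_antisymm ((h _ _ _ _ (hg _) (hf x)).2 le_rfl) ((h _ _ _ _ (hf x) (hg _)).2 le_rfl)
  · exact le_antisymm ((h _ _ _ _ (hf _) (hg y)).1 le_rfl) ((h _ _ _ _ (hg y) (hf _)).1 le_rfl)

variable {α : Type*} [GeneralizedBooleanAlgebra α]

/-- A symmetric relation on a generalized Boolean algebra along which decompositions lift. -/
structure IsBackAndForth (S : α → α → Prop) : Prop where
  symm : ∀ {a b}, S a b → S b a
  eq_bot : ∀ {a b}, S a b → a = ⊥ → b = ⊥
  lift : ∀ {a b}, S a b → ∀ c ≤ a, ∃ d ≤ b, S c d ∧ S (a \ c) (b \ d)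

variable {S : α → α → Prop}

theorem IsBackAndForth.exists_split (hS : IsBackAndForth S) (z : α ⊕ α)
    (N : {N : α × α // S N.1 N.2}) :
    ∃ c d, c ≤ N.1.1 ∧ d ≤ N.1.2 ∧ S c d ∧ S (N.1.1 \ c) (N.1.2 \ d) ∧
      z.elim (fun x => c = N.1.1 ⊓ x) (fun y => d = N.1.2 ⊓ y) := by
  obtain ⟨⟨a, b⟩, h⟩ := N
  cases z with
  | inl x =>
    obtain ⟨d, hd, h1, h2⟩ := hS.lift h (a ⊓ x) inf_le_left
    exact ⟨_, d, inf_le_left, hd, h1, h2, rfl⟩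
  | inr y =>
    obtain ⟨c, hc, h1, h2⟩ := hS.lift (hS.symm h) (b ⊓ y) inf_le_left
    exact ⟨c, _, hc, inf_le_left, hS.symm h1, hS.symm h2, rfl⟩

/-- `x` and `y` agree on all cells reached after `k` steps, where at step `n` the related pair `N`
is split into the pairs `L n N` and `R n N`. -/
def AgreeAfter {ν : Type*} (p : ν → α × α) (L R : ℕ → ν → ν) : ℕ → ℕ → ν → α → α → Prop
  | 0, _, N, x, y =>
    ((p N).1 ≤ x ∧ (p N).2 ≤ y) ∨ (Disjoint (p N).1 x ∧ Disjoint (p N).2 y)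
  | k + 1, n, N, x, y =>
    AgreeAfter p L R k (n + 1) (L n N) x y ∧ AgreeAfter p L R k (n + 1) (R n N) x y

section AgreeAfter

variable {ν : Type*} {p : ν → α × α} {L R : ℕ → ν → ν}

theorem AgreeAfter.congr (h1 : ∀ n N, (p (L n N)).1 ⊔ (p (R n N)).1 = (p N).1)
    (h2 : ∀ n N, (p (L n N)).2 ⊔ (p (R n N)).2 = (p N).2) {k n : ℕ} {N : ν} {x y x' y' : α}
    (h : AgreeAfter p L R k n N x y) (hx : (p N).1 ⊓ x = (p N).1 ⊓ x')
    (hy : (p N).2 ⊓ y = (p N).2 ⊓ y') : AgreeAfter p L R k n N x' y' := by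
  induction k generalizing n N with
  | zero =>
    simp only [AgreeAfter, disjoint_iff, ← inf_eq_left (b := x), ← inf_eq_left (b := y),
      ← inf_eq_left (b := x'), ← inf_eq_left (b := y'), hx, hy] at h ⊢
    exact h
  | succ k ih =>
    have key : ∀ {a b u w : α}, a ≤ b → b ⊓ u = b ⊓ w → a ⊓ u = a ⊓ w := by
      intro a b u w hab e
      rw [← inf_eq_left.2 hab, inf_assoc, e, inf_assoc]
    refine ⟨ih h.1 (key ?_ hx) (key ?_ hy), ih h.2 (key ?_ hx) (key ?_ hy)⟩
    · exact (h1 n N) ▸ le_sup_left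
    · exact (h2 n N) ▸ le_sup_left
    · exact (h1 n N) ▸ le_sup_right
    · exact (h2 n N) ▸ le_sup_right

theorem AgreeAfter.succ (h1 : ∀ n N, (p (L n N)).1 ⊔ (p (R n N)).1 = (p N).1)
    (h2 : ∀ n N, (p (L n N)).2 ⊔ (p (R n N)).2 = (p N).2) {k n : ℕ} {N : ν} {x y : α}
    (h : AgreeAfter p L R k n N x y) : AgreeAfter p L R (k + 1) n N x y := by
  induction k generalizing n N with
  | zero =>
    have l1 : (p (L n N)).1 ≤ (p N).1 := (h1 n N) ▸ le_sup_left
    have l2 : (p (L n N)).2 ≤ (p N).2 := (h2 n N) ▸ le_sup_left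
    have r1 : (p (R n N)).1 ≤ (p N).1 := (h1 n N) ▸ le_sup_right
    have r2 : (p (R n N)).2 ≤ (p N).2 := (h2 n N) ▸ le_sup_right
    rcases h with ⟨ha, hb⟩ | ⟨ha, hb⟩
    · exact ⟨Or.inl ⟨l1.trans ha, l2.trans hb⟩, Or.inl ⟨r1.trans ha, r2.trans hb⟩⟩
    · exact ⟨Or.inr ⟨ha.mono_left l1, hb.mono_left l2⟩, Or.inr ⟨ha.mono_left r1, hb.mono_left r2⟩⟩
  | succ k ih => exact ⟨ih h.1, ih h.2⟩

theorem AgreeAfter.mono (h1 : ∀ n N, (p (L n N)).1 ⊔ (p (R n N)).1 = (p N).1)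
    (h2 : ∀ n N, (p (L n N)).2 ⊔ (p (R n N)).2 = (p N).2) {k m n : ℕ} {N : ν} {x y : α}
    (h : AgreeAfter p L R k n N x y) (hkm : k ≤ m) : AgreeAfter p L R m n N x y := by
  induction m, hkm using Nat.le_induction with
  | base => exact h
  | succ m _ ih => exact ih.succ h1 h2

theorem AgreeAfter.le_iff_le (h1 : ∀ n N, (p (L n N)).1 ⊔ (p (R n N)).1 = (p N).1)
    (h2 : ∀ n N, (p (L n N)).2 ⊔ (p (R n N)).2 = (p N).2)
    (h0 : ∀ N, (p N).1 = ⊥ ↔ (p N).2 = ⊥) {k n : ℕ} {N : ν} {x y x' y' : α}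
    (h : AgreeAfter p L R k n N x y) (h' : AgreeAfter p L R k n N x' y') :
    (p N).1 ⊓ x ≤ x' ↔ (p N).2 ⊓ y ≤ y' := by
  induction k generalizing n N with
  | zero =>
    rcases h with ⟨ha, hb⟩ | ⟨ha, hb⟩
    · rw [inf_eq_left.2 ha, inf_eq_left.2 hb]
      rcases h' with ⟨ha', hb'⟩ | ⟨ha', hb'⟩
      · exact iff_of_true ha' hb'
      · rw [← inf_eq_left, ha'.eq_bot, ← inf_eq_left, hb'.eq_bot, eq_comm, h0, eq_comm]
    · simp [ha.eq_bot, hb.eq_bot]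
  | succ k ih =>
    rw [← h1 n N, ← h2 n N, inf_sup_right, inf_sup_right, sup_le_iff, sup_le_iff,
      ih h.1 h'.1, ih h.2 h'.2]

theorem exists_agreeAfter (h1 : ∀ n N, (p (L n N)).1 ⊔ (p (R n N)).1 = (p N).1)
    (h2 : ∀ n N, (p (L n N)).2 ⊔ (p (R n N)).2 = (p N).2)
    (d1 : ∀ n N, Disjoint (p (L n N)).1 (p (R n N)).1)
    (d2 : ∀ n N, Disjoint (p (L n N)).2 (p (R n N)).2) (z : ℕ → α ⊕ α)
    (hz : ∀ n N, (z n).elim (fun x => (p (L n N)).1 = (p N).1 ⊓ x)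
      (fun y => (p (L n N)).2 = (p N).2 ⊓ y)) (k n : ℕ) (N : ν) :
    ∃ x ≤ (p N).1, ∃ y ≤ (p N).2, AgreeAfter p L R (k + 1) n N x y ∧
      (z (n + k)).elim (fun x' => x = (p N).1 ⊓ x') (fun y' => y = (p N).2 ⊓ y') := by
  induction k generalizing n N with
  | zero =>
    refine ⟨(p (L n N)).1, (h1 n N) ▸ le_sup_left, (p (L n N)).2, (h2 n N) ▸ le_sup_left,
      ⟨Or.inl ⟨le_rfl, le_rfl⟩, Or.inr ⟨(d1 n N).symm, (d2 n N).symm⟩⟩, hz n N⟩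
  | succ k ih =>
    obtain ⟨xl, hxl, yl, hyl, hl, hl'⟩ := ih (n + 1) (L n N)
    obtain ⟨xr, hxr, yr, hyr, hr, hr'⟩ := ih (n + 1) (R n N)
    refine ⟨xl ⊔ xr, (h1 n N) ▸ sup_le_sup hxl hxr, yl ⊔ yr, (h2 n N) ▸ sup_le_sup hyl hyr,
      ⟨hl.congr h1 h2 ?_ ?_, hr.congr h1 h2 ?_ ?_⟩, ?_⟩
    · rw [inf_sup_left, ((d1 n N).mono_right hxr).eq_bot, sup_bot_eq]
    · rw [inf_sup_left, ((d2 n N).mono_right hyr).eq_bot, sup_bot_eq]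
    · rw [inf_sup_left, ((d1 n N).symm.mono_right hxl).eq_bot, bot_sup_eq]
    · rw [inf_sup_left, ((d2 n N).symm.mono_right hyl).eq_bot, bot_sup_eq]
    · rw [show n + (k + 1) = n + 1 + k by omega]
      cases hzk : z (n + 1 + k) with
      | inl x' =>
        simp only [hzk, Sum.elim_inl] at hl' hr' ⊢
        rw [hl', hr', ← inf_sup_right, h1]
      | inr y' =>
        simp only [hzk, Sum.elim_inr] at hl' hr' ⊢
        rw [hl', hr', ← inf_sup_right, h2]

end AgreeAfter

/-- The Vaught criterion: in a countable generalized Boolean algebra, elements related by a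
back-and-forth relation generate isomorphic ideals. -/
theorem IsBackAndForth.nonempty_orderIso [Countable α] (hS : IsBackAndForth S) {a b : α}
    (h : S a b) : Nonempty (Iic a ≃o Iic b) := by
  obtain ⟨z, hz⟩ := exists_surjective_nat (α ⊕ α)
  choose c d hc hd hL hR hs using hS.exists_split
  let ν := {N : α × α // S N.1 N.2}
  let p : ν → α × α := Subtype.val
  let L : ℕ → ν → ν := fun n N => ⟨(c (z n) N, d (z n) N), hL _ _⟩
  let R : ℕ → ν → ν := fun n N => ⟨(N.1.1 \ c (z n) N, N.1.2 \ d (z n) N), hR _ _⟩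
  have h1 : ∀ n N, (p (L n N)).1 ⊔ (p (R n N)).1 = (p N).1 :=
    fun n N => sup_sdiff_cancel_right (hc _ _)
  have h2 : ∀ n N, (p (L n N)).2 ⊔ (p (R n N)).2 = (p N).2 :=
    fun n N => sup_sdiff_cancel_right (hd _ _)
  have h0 : ∀ N, (p N).1 = ⊥ ↔ (p N).2 = ⊥ :=
    fun N => ⟨hS.eq_bot N.2, hS.eq_bot (hS.symm N.2)⟩
  have ex := exists_agreeAfter h1 h2 (fun _ _ => disjoint_sdiff_self_right)
    (fun _ _ => disjoint_sdiff_self_right) z (fun n N => hs (z n) N)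
  refine nonempty_orderIso_of_rel
    (fun (x : Iic a) (y : Iic b) => ∃ k, AgreeAfter p L R k 0 ⟨(a, b), h⟩ x.1 y.1) ?_ ?_ ?_
  · rintro ⟨x, hx⟩
    obtain ⟨k, hk⟩ := hz (Sum.inl x)
    obtain ⟨x', -, y, hy, hxy, e⟩ := ex k 0 ⟨(a, b), h⟩
    rw [zero_add, hk] at e
    have e : x' = x := Eq.trans e (inf_eq_right.2 hx)
    exact ⟨⟨y, hy⟩, k + 1, e ▸ hxy⟩
  · rintro ⟨y, hy⟩
    obtain ⟨k, hk⟩ := hz (Sum.inr y)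
    obtain ⟨x, hx, y', -, hxy, e⟩ := ex k 0 ⟨(a, b), h⟩
    rw [zero_add, hk] at e
    have e : y' = y := Eq.trans e (inf_eq_right.2 hy)
    exact ⟨⟨x, hx⟩, k + 1, e ▸ hxy⟩
  · rintro ⟨x, hx⟩ ⟨y, hy⟩ ⟨x', hx'⟩ ⟨y', hy'⟩ ⟨k, hk⟩ ⟨m, hm⟩
    have := (hk.mono h1 h2 (le_max_left k m)).le_iff_le h1 h2 h0
      (hm.mono h1 h2 (le_max_right k m))
    have e1 : a ⊓ x = x := inf_eq_right.2 hx
    have e2 : b ⊓ y = y := inf_eq_right.2 hy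
    simp only [p, e1, e2] at this
    exact this

end BackAndForth

section DisjointSums

variable {α : Type*} [GeneralizedBooleanAlgebra α]

/-- `a` is a disjoint union of finitely many elements satisfying `T`. -/
inductive IsDisjointSum (T : α → Prop) : α → Prop
  | bot : IsDisjointSum T ⊥
  | cons {d a : α} : T d → Disjoint d a → IsDisjointSum T a → IsDisjointSum T (d ⊔ a)

theorem IsDisjointSum.exists_finset {T T' : α → Prop} {a : α} (h : IsDisjointSum T a)
    (hT : ∀ d, T d → T' d) :
    ∃ F : Finset α, (∀ b ∈ F, T' b) ∧ (F : Set α).PairwiseDisjoint id ∧ F.sup id = a := by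
  classical
  induction h with
  | bot => exact ⟨∅, by simp⟩
  | @cons d a hd hda _ ih =>
    obtain ⟨F, hF, hdisj, rfl⟩ := ih
    refine ⟨insert d F, ?_, ?_, by simp⟩
    · intro b hb
      rcases Finset.mem_insert.1 hb with rfl | hb
      · exact hT _ hd
      · exact hF b hb
    · rw [Finset.coe_insert]
      exact hdisj.insert fun b hb _ => hda.mono_right (Finset.le_sup (f := id) hb)

/-- A pseudo-indecomposable disjoint union is isomorphic to one of its summands. -/
theorem IsDisjointSum.exists_orderIso_of_isPI {T : α → Prop} {a : α} (h : IsDisjointSum T a)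
    (ha : IsPI a) : ∃ d ≤ a, T d ∧ Nonempty (Iic d ≃o Iic a) := by
  induction h with
  | bot => exact absurd rfl ha.1
  | @cons d a hd hda _ ih =>
    rcases ha.2 d le_sup_left with he | he
    · exact ⟨d, le_sup_left, hd, he⟩
    · rw [sup_sdiff_left_self, hda.symm.sdiff_eq_left] at he
      obtain ⟨e⟩ := he
      obtain ⟨c, hc, hTc, ⟨f⟩⟩ := ih (ha.of_orderIso e.symm)
      exact ⟨c, hc.trans le_sup_right, hTc, ⟨f.trans e⟩⟩

/-- The elements `a` and `b` are disjoint unions of finitely many elements, matched so that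
corresponding summands have a common type with respect to `τ`. -/
inductive SameTypeSum {ι : Type*} (τ : α → ι → Prop) : α → α → Prop
  | bot : SameTypeSum τ ⊥ ⊥
  | of {d e : α} {i : ι} : τ d i → τ e i → SameTypeSum τ d e
  | add {a b a' b' : α} : Disjoint a a' → Disjoint b b' → SameTypeSum τ a b →
      SameTypeSum τ a' b' → SameTypeSum τ (a ⊔ a') (b ⊔ b')

variable {ι : Type*} {τ : α → ι → Prop}

theorem SameTypeSum.symm {a b : α} (h : SameTypeSum τ a b) : SameTypeSum τ b a := by
  induction h with
  | bot => exact .bot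
  | of hd he => exact .of he hd
  | add h1 h2 _ _ ih1 ih2 => exact .add h2 h1 ih1 ih2

/-- Decompositions lift along `SameTypeSum` as soon as they do between elements of equal type. -/
theorem SameTypeSum.isBackAndForth (hbot : ∀ d i, τ d i → d ≠ ⊥)
    (hlift : ∀ d e i, τ d i → τ e i → ∀ c ≤ d, ∃ c' ≤ e,
      SameTypeSum τ c c' ∧ SameTypeSum τ (d \ c) (e \ c')) :
    IsBackAndForth (SameTypeSum τ) where
  symm := SameTypeSum.symm
  eq_bot := by
    intro a b h
    induction h with
    | bot => exact id
    | of hd _ => exact fun h0 => absurd h0 (hbot _ _ hd)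
    | add _ _ _ _ ih1 ih2 =>
      rw [sup_eq_bot_iff, sup_eq_bot_iff]
      exact fun h => ⟨ih1 h.1, ih2 h.2⟩
  lift := by
    intro a b h
    induction h with
    | bot =>
      intro c hc
      obtain rfl := le_bot_iff.1 hc
      exact ⟨⊥, le_rfl, .bot, by simpa using .bot⟩
    | of hd he => exact hlift _ _ _ hd he
    | @add a b a' b' h1 h2 _ _ ih1 ih2 =>
      intro c hc
      obtain ⟨d, hd, s1, s2⟩ := ih1 (c ⊓ a) inf_le_right
      obtain ⟨d', hd', s1', s2'⟩ := ih2 (c ⊓ a') inf_le_right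
      have hsd : ∀ {x y z w : α}, Disjoint x y → z ≤ x → w ≤ y →
          (x ⊔ y) \ (z ⊔ w) = x \ z ⊔ y \ w := by
        intro x y z w hxy hz hw
        rw [sup_sdiff, ← sdiff_sdiff_left, (hxy.mono sdiff_le hw).sdiff_eq_left, sup_comm z,
          ← sdiff_sdiff_left, (hxy.symm.mono sdiff_le hz).sdiff_eq_left]
      refine ⟨d ⊔ d', sup_le_sup hd hd', ?_, ?_⟩
      · have e : c = c ⊓ a ⊔ c ⊓ a' := by rw [← inf_sup_left, inf_eq_left.2 hc]
        rw [e]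
        exact .add (h1.mono inf_le_right inf_le_right) (h2.mono hd hd') s1 s1'
      · have e : c = c ⊓ a ⊔ c ⊓ a' := by rw [← inf_sup_left, inf_eq_left.2 hc]
        rw [e, hsd h1 inf_le_right inf_le_right, hsd h2 hd hd']
        exact .add (h1.mono sdiff_le sdiff_le) (h2.mono sdiff_le sdiff_le) s2 s2'

end DisjointSums

instance TopologicalSpace.CompactOpens.instCountable {W : Type*} [TopologicalSpace W]
    [SecondCountableTopology W] : Countable (CompactOpens W) := by
  have hb := isBasis_countableBasis W
  have key : ∀ A : CompactOpens W, ∃ s : Finset (countableBasis W), (A : Set W) = ⋃ i ∈ s, i.1 := by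
    intro A
    obtain ⟨s, hs, hA⟩ := eq_finite_iUnion_of_isTopologicalBasis_of_isCompact_open
      (fun i : countableBasis W => i.1) (by simpa using hb) A A.isCompact A.isOpen
    exact ⟨hs.toFinset, by simpa using hA⟩
  choose f hf using key
  refine Function.Injective.countable (f := f) fun A B h => ?_
  apply CompactOpens.ext
  rw [hf A, hf B, h]

theorem partType_mono {W P : Type*} {Z : P → Set W} {A B : Set W} (h : A ⊆ B) :
    partType Z A ⊆ partType Z B :=
  fun _ hp => hp.mono (inter_subset_inter_left _ h)

theorem partType_sup {W P : Type*} [TopologicalSpace W] {Z : P → Set W} {A C : CompactOpens W} :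
    partType Z ((A ⊔ C : CompactOpens W) : Set W) = partType Z A ∪ partType Z C := by
  ext q
  simp [partType, union_inter_distrib_right, union_nonempty]

section WeaklyTrim

variable {W : Type u} [TopologicalSpace W] {P : Type v} [POSystem P]

theorem POSystem.lt_of_Le_of_lt {p q r : P} (h : POSystem.Le p q) (h' : q < r) : p < r := by
  rcases h with h | rfl
  · exact POSystem.trans' h h'
  · exact h'

theorem POSystem.Le.antisymm {p q : P} (h : POSystem.Le p q) (h' : POSystem.Le q p) : p = q := by
  rcases h with h | rfl
  · rcases h' with h' | rfl
    · exact POSystem.antisymm' h h'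
    · rfl
  · rfl

/-- The part of the definition of a trim partition that is inherited by the amalgamation of blocks
along a morphism of PO systems. -/
structure IsWeaklyTrim (Z : P → Set W) : Prop where
  /-- Every point of `Z p` is an accumulation point of `Z q` for all `q > p`. -/
  acc : ∀ p q, p < q → Z p ⊆ derivedSet (Z q)
  base : ∀ w : W, ∀ U ∈ 𝓝 w, ∃ A : CompactOpens W, IsTrim Z A ∧ w ∈ A ∧ (A : Set W) ⊆ U
  clean : ∀ p, ∀ w ∈ Z p, ∃ A : CompactOpens W, IsTrimAt Z A p ∧ w ∈ A

variable {Z : P → Set W}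

theorem IsTrimAt.mem_partType {A : CompactOpens W} {p : P} (h : IsTrimAt Z A p) :
    p ∈ partType Z A := by
  rw [h.1]
  exact Or.inr rfl

theorem IsTrimAt.ne_bot {A : CompactOpens W} {p : P} (h : IsTrimAt Z A p) : A ≠ ⊥ := by
  rintro rfl
  obtain ⟨w, hw, -⟩ := h.mem_partType
  exact hw

theorem IsWeaklyTrim.exists_ne_mem (hZ : IsWeaklyTrim Z) {p q : P} (h : p < q) {w : W}
    (hw : w ∈ Z p) {U : Set W} (hU : U ∈ 𝓝 w) : ∃ x ∈ U ∩ Z q, x ≠ w :=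
  accPt_iff_nhds.1 (hZ.acc p q h hw) U hU

theorem IsWeaklyTrim.partType_upper (hZ : IsWeaklyTrim Z) {A : CompactOpens W} {p q : P}
    (hp : p ∈ partType Z A) (h : POSystem.Le p q) : q ∈ partType Z A := by
  rcases h with h | rfl
  · obtain ⟨w, hwA, hw⟩ := hp
    obtain ⟨x, hx, -⟩ := hZ.exists_ne_mem h hw (A.isOpen.mem_nhds hwA)
    exact ⟨x, hx⟩
  · exact hp

theorem IsWeaklyTrim.isTrimAt_of_le (hZ : IsWeaklyTrim Z) {A B : CompactOpens W} {p : P}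
    (hA : IsTrimAt Z A p) (hBA : B ≤ A) (hB : p ∈ partType Z B) : IsTrimAt Z B p := by
  refine ⟨Subset.antisymm ?_ fun q hq => hZ.partType_upper hB hq, fun hp => ?_⟩
  · rw [← hA.1]
    exact partType_mono hBA
  · apply le_antisymm
    · rw [← hA.2 hp]
      exact encard_le_encard (inter_subset_inter_left _ hBA)
    · exact one_le_encard_iff_nonempty.2 hB

theorem IsTrimAt.sup {A C : CompactOpens W} {p : P} (hA : IsTrimAt Z A p)
    (hC : ∀ q ∈ partType Z C, p < q) : IsTrimAt Z (A ⊔ C) p := by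
  refine ⟨?_, fun hp => ?_⟩
  · rw [partType_sup, hA.1]
    exact union_eq_left.2 fun q hq => Or.inl (hC q hq)
  · have : (C : Set W) ∩ Z p = ∅ := by
      rw [← not_nonempty_iff_eq_empty]
      exact fun h => hp (hC p h)
    rw [CompactOpens.coe_sup, union_inter_distrib_right, this, union_empty, hA.2 hp]

variable [T2Space W]

theorem IsWeaklyTrim.exists_isTrimAt_subset (hZ : IsWeaklyTrim Z) {p : P} {w : W} (hw : w ∈ Z p)
    {U : Set W} (hU : U ∈ 𝓝 w) :
    ∃ A : CompactOpens W, IsTrimAt Z A p ∧ w ∈ A ∧ (A : Set W) ⊆ U := by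
  obtain ⟨A, hA, hwA⟩ := hZ.clean p w hw
  obtain ⟨B, -, hwB, hBU⟩ := hZ.base w U hU
  exact ⟨A ⊓ B, hZ.isTrimAt_of_le hA inf_le_left ⟨w, ⟨hwA, hwB⟩, hw⟩, ⟨hwA, hwB⟩,
    inter_subset_right.trans hBU⟩

theorem IsTrimAt.lt_of_mem_partType_sdiff {A B : CompactOpens W} {p q : P} (hA : IsTrimAt Z A p)
    (hBA : B ≤ A) (hB : p ∈ partType Z B)
    (hq : q ∈ partType Z ((A \ B : CompactOpens W) : Set W)) : p < q := by
  have hpq : q ∈ partType Z A := partType_mono sdiff_subset hq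
  rw [hA.1] at hpq
  rcases hpq with h | rfl
  · exact h
  · by_contra hp
    obtain ⟨x, hx⟩ := encard_eq_one.1 (hA.2 hp)
    obtain ⟨y, hy, hyp⟩ := hB
    obtain ⟨z, hz, hzp⟩ := hq
    have h1 : y ∈ (A : Set W) ∩ Z p := ⟨hBA hy, hyp⟩
    have h2 : z ∈ (A : Set W) ∩ Z p := ⟨hz.1, hzp⟩
    rw [hx] at h1 h2
    have e : z = y := h2.trans h1.symm
    exact hz.2 (e ▸ hy)

/-- A `p`-trim set can be split into a `p`-trim set and a `q`-trim set for every `q > p`. -/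
theorem IsWeaklyTrim.exists_isTrimAt_sdiff (hZ : IsWeaklyTrim Z) {A : CompactOpens W} {p q : P}
    (hA : IsTrimAt Z A p) (h : p < q) :
    ∃ C ≤ A, IsTrimAt Z C q ∧ IsTrimAt Z (A \ C) p := by
  obtain ⟨w, hwA, hw⟩ := hA.mem_partType
  obtain ⟨x, ⟨hxA, hx⟩, hxw⟩ := hZ.exists_ne_mem h hw (A.isOpen.mem_nhds hwA)
  obtain ⟨C, hC, -, hCs⟩ := hZ.exists_isTrimAt_subset hx
    (Filter.inter_mem (A.isOpen.mem_nhds hxA) (isOpen_compl_singleton.mem_nhds hxw))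
  refine ⟨C, fun y hy => (hCs hy).1, hC, hZ.isTrimAt_of_le hA sdiff_le ⟨w, ⟨hwA, ?_⟩, hw⟩⟩
  exact fun hwC => (hCs hwC).2 rfl

theorem IsDisjointSum.sup_of_isTrim {A C : CompactOpens W} (hA : IsDisjointSum (IsTrim Z) A)
    {p : P} (hp : p ∈ partType Z A) (hAC : Disjoint A C) (hC : ∀ q ∈ partType Z C, p < q) :
    IsDisjointSum (IsTrim Z) (A ⊔ C) := by
  induction hA with
  | bot =>
    obtain ⟨w, hw, -⟩ := hp
    exact absurd hw (notMem_empty w)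
  | @cons D A hD hDA hA ih =>
    rw [disjoint_sup_left] at hAC
    rw [partType_sup] at hp
    rcases hp with hp | hp
    · obtain ⟨q, hD⟩ := hD
      rw [hD.1] at hp
      have := hD.sup fun r hr => POSystem.lt_of_Le_of_lt hp (hC r hr)
      rw [sup_right_comm]
      exact .cons ⟨q, this⟩ (disjoint_sup_left.2 ⟨hDA, hAC.2.symm⟩) hA
    · rw [sup_assoc]
      exact .cons hD (disjoint_sup_right.2 ⟨hDA, hAC.1⟩) (ih hp hAC.2)

theorem IsWeaklyTrim.isDisjointSum_sup (hZ : IsWeaklyTrim Z) {A B : CompactOpens W}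
    (hA : IsDisjointSum (IsTrim Z) A) (hB : IsTrim Z B) : IsDisjointSum (IsTrim Z) (A ⊔ B) := by
  obtain ⟨p, hB⟩ := hB
  by_cases hp : p ∈ partType Z ((B \ A : CompactOpens W) : Set W)
  · rw [← sup_sdiff_self_right, sup_comm]
    exact .cons ⟨p, hZ.isTrimAt_of_le hB sdiff_le hp⟩ disjoint_sdiff_self_left hA
  · obtain ⟨w, hwB, hw⟩ := hB.mem_partType
    have hwA : w ∈ A := by
      by_contra hwA
      exact hp ⟨w, ⟨hwB, hwA⟩, hw⟩
    rw [← sup_sdiff_self_right]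
    refine hA.sup_of_isTrim ⟨w, hwA, hw⟩ disjoint_sdiff_self_right fun q hq => ?_
    have hq' : q ∈ partType Z B := partType_mono sdiff_subset hq
    rw [hB.1] at hq'
    rcases hq' with h | rfl
    · exact h
    · exact absurd hq hp

/-- Every compact open set is a finite disjoint union of trim sets. -/
theorem IsWeaklyTrim.isDisjointSum (hZ : IsWeaklyTrim Z) (A : CompactOpens W) :
    IsDisjointSum (IsTrim Z) A := by
  suffices h : ∃ B : CompactOpens W, IsDisjointSum (IsTrim Z) B ∧ A ≤ B ∧ B ≤ A by
    obtain ⟨B, hB, h1, h2⟩ := h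
    rwa [le_antisymm h1 h2]
  refine A.isCompact.induction_on
    (p := fun s => ∃ B : CompactOpens W, IsDisjointSum (IsTrim Z) B ∧ s ⊆ B ∧ B ≤ A)
    ⟨⊥, .bot, empty_subset _, bot_le⟩ ?_ ?_ ?_
  · rintro s t hst ⟨B, hB, h1, h2⟩
    exact ⟨B, hB, hst.trans h1, h2⟩
  · rintro s t ⟨B, hB, h1, h2⟩ ⟨C, hC, h1', h2'⟩
    refine ⟨B ⊔ C, ?_, union_subset_union h1 h1', sup_le h2 h2'⟩
    clear h1 h1' h2 h2'
    induction hC with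
    | bot => rwa [sup_bot_eq]
    | @cons D C hD _ _ ih =>
      rw [sup_left_comm, sup_comm]
      exact hZ.isDisjointSum_sup ih hD
  · intro w hw
    obtain ⟨B, hB, hwB, hBA⟩ := hZ.base w A (A.isOpen.mem_nhds hw)
    refine ⟨B, mem_nhdsWithin_of_mem_nhds (B.isOpen.mem_nhds hwB), B, ?_, Subset.rfl, hBA⟩
    have := IsDisjointSum.cons hB disjoint_bot_right (.bot (T := IsTrim Z))
    rwa [sup_bot_eq] at this

theorem IsWeaklyTrim.exists_sameTypeSum (hZ : IsWeaklyTrim Z) {X E : CompactOpens W} {p : P}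
    (hX : ∀ q ∈ partType Z X, p < q) (hE : IsTrimAt Z E p) :
    ∃ G ≤ E, IsTrimAt Z (E \ G) p ∧ SameTypeSum (IsTrimAt Z) X G := by
  have h := hZ.isDisjointSum X
  induction h with
  | bot => exact ⟨⊥, bot_le, by rwa [sdiff_bot], .bot⟩
  | @cons F X hF hFX _ ih =>
    rw [partType_sup] at hX
    obtain ⟨G, hG, hEG, hXG⟩ := ih fun q hq => hX q (Or.inr hq)
    obtain ⟨s, hF⟩ := hF
    obtain ⟨C, hC, hCs, hEC⟩ := hZ.exists_isTrimAt_sdiff hEG (hX s (Or.inl hF.mem_partType))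
    refine ⟨C ⊔ G, sup_le (hC.trans sdiff_le) hG, ?_, ?_⟩
    · rwa [sdiff_sdiff_left, sup_comm] at hEC
    · exact .add hFX (disjoint_sdiff_self_left.mono_left hC) (.of hF hCs) hXG

theorem IsWeaklyTrim.isBackAndForth (hZ : IsWeaklyTrim Z) :
    IsBackAndForth (SameTypeSum (IsTrimAt Z)) := by
  refine SameTypeSum.isBackAndForth (fun d p h => h.ne_bot) ?_
  have key : ∀ D E p, IsTrimAt Z D p → IsTrimAt Z E p → ∀ C ≤ D, p ∈ partType Z C → ∃ G ≤ E,
      SameTypeSum (IsTrimAt Z) C (E \ G) ∧ SameTypeSum (IsTrimAt Z) (D \ C) G := by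
    intro D E p hD hE C hC hp
    obtain ⟨G, hG, hEG, h⟩ := hZ.exists_sameTypeSum
      (fun q => hD.lt_of_mem_partType_sdiff hC hp) hE
    exact ⟨G, hG, .of (hZ.isTrimAt_of_le hD hC hp) hEG, h⟩
  intro D E p hD hE C hC
  by_cases hp : p ∈ partType Z C
  · obtain ⟨G, hG, h1, h2⟩ := key D E p hD hE C hC hp
    exact ⟨E \ G, sdiff_le, h1, by rwa [sdiff_sdiff_eq_self hG]⟩
  · have hp' : p ∈ partType Z ((D \ C : CompactOpens W) : Set W) := by
      obtain ⟨w, hwD, hw⟩ := hD.mem_partType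
      exact ⟨w, ⟨hwD, fun hwC => hp ⟨w, hwC, hw⟩⟩, hw⟩
    obtain ⟨G, hG, h1, h2⟩ := key D E p hD hE (D \ C) sdiff_le hp'
    rw [sdiff_sdiff_eq_self hC] at h2
    exact ⟨G, hG, h2, h1⟩

/-- Trim sets of the same type generate isomorphic ideals. -/
theorem IsWeaklyTrim.nonempty_orderIso [SecondCountableTopology W] (hZ : IsWeaklyTrim Z)
    {A B : CompactOpens W} {p : P} (hA : IsTrimAt Z A p) (hB : IsTrimAt Z B p) :
    Nonempty (Iic A ≃o Iic B) :=
  hZ.isBackAndForth.nonempty_orderIso (.of hA hB)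

/-- Trim sets are pseudo-indecomposable. -/
theorem IsWeaklyTrim.isPI [SecondCountableTopology W] (hZ : IsWeaklyTrim Z)
    {A : CompactOpens W} {p : P} (hA : IsTrimAt Z A p) : IsPI A := by
  refine ⟨hA.ne_bot, fun B hB => ?_⟩
  obtain ⟨w, hwA, hw⟩ := hA.mem_partType
  by_cases hwB : w ∈ B
  · exact Or.inl (hZ.nonempty_orderIso (hZ.isTrimAt_of_le hA hB ⟨w, hwB, hw⟩) hA)
  · exact Or.inr (hZ.nonempty_orderIso (hZ.isTrimAt_of_le hA sdiff_le ⟨w, ⟨hwA, hwB⟩, hw⟩) hA)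

end WeaklyTrim

/-- The family obtained from `Y` by merging the blocks with the same image under `β`. -/
def amalgamate {W P R : Type*} (β : P → R) (Y : P → Set W) (r : R) : Set W :=
  ⋃ p ∈ {p | β p = r}, Y p

theorem mem_amalgamate {W P R : Type*} {β : P → R} {Y : P → Set W} {r : R} {w : W} :
    w ∈ amalgamate β Y r ↔ ∃ p, β p = r ∧ w ∈ Y p := by
  simp [amalgamate]

section Amalgamation

variable {W : Type u} [TopologicalSpace W] {P : Type v} [POSystem P]

theorem IsTrimPartition.acc {Y : P → Set W} (hY : IsTrimPartition Y) {p q : P} (h : p < q) :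
    Y p ⊆ derivedSet (Y q) := by
  intro w hw
  have : w ∈ derivedSet (Y q) ∩ ⋃ r, Y r := by
    rw [hY.derived q]
    exact mem_biUnion (show p ∈ {r | r < q} from h) hw
  exact this.1

theorem IsTrimPartition.isWeaklyTrim {Y : P → Set W} (hY : IsTrimPartition Y) :
    IsWeaklyTrim Y where
  acc _ _ h := hY.acc h
  base := hY.base
  clean := hY.clean

variable {R : Type*} [POSystem R] {β : P → R} {Y : P → Set W}

theorem IsPOMorphism.lt {Q : Type*} [POSystem Q] {β : P → Q} (hβ : IsPOMorphism β) {p q : P}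
    (h : p < q) : β p < β q := by
  have : β q ∈ β '' {r | p < r} := ⟨q, h, rfl⟩
  rwa [hβ p] at this

theorem IsPOMorphism.exists_lt {Q : Type*} [POSystem Q] {β : P → Q} (hβ : IsPOMorphism β) {p : P}
    {s : Q} (h : β p < s) : ∃ q, p < q ∧ β q = s := by
  have : s ∈ β '' {r | p < r} := by
    rw [hβ p]
    exact h
  exact this

theorem IsTrimAt.amalgamate (hβ : IsPOMorphism β) {A : CompactOpens W} {p : P}
    (hA : IsTrimAt Y A p) : IsTrimAt (amalgamate β Y) A (β p) := by
  refine ⟨?_, fun hp => ?_⟩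
  · ext r
    constructor
    · rintro ⟨w, hwA, hw⟩
      obtain ⟨q, rfl, hwq⟩ := mem_amalgamate.1 hw
      have hq : q ∈ partType Y A := ⟨w, hwA, hwq⟩
      rw [hA.1] at hq
      rcases hq with h | rfl
      · exact Or.inl (hβ.lt h)
      · exact Or.inr rfl
    · intro hr
      obtain ⟨q, hq, rfl⟩ : ∃ q, POSystem.Le p q ∧ β q = r := by
        rcases hr with h | rfl
        · obtain ⟨q, hq, hqr⟩ := hβ.exists_lt h
          exact ⟨q, Or.inl hq, hqr⟩
        · exact ⟨p, Or.inr rfl, rfl⟩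
      have hq : q ∈ partType Y A := by rwa [hA.1]
      obtain ⟨w, hwA, hw⟩ := hq
      exact ⟨w, hwA, mem_amalgamate.2 ⟨q, rfl, hw⟩⟩
  · rw [← hA.2 fun h => hp (hβ.lt h)]
    congr 1
    ext w
    constructor
    · rintro ⟨hwA, hw⟩
      obtain ⟨q, hqp, hw⟩ := mem_amalgamate.1 hw
      have hq : q ∈ partType Y A := ⟨w, hwA, hw⟩
      rw [hA.1] at hq
      rcases hq with h | rfl
      · have := hβ.lt h
        rw [hqp] at this
        exact absurd this hp
      · exact ⟨hwA, hw⟩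
    · rintro ⟨hwA, hw⟩
      exact ⟨hwA, mem_amalgamate.2 ⟨p, rfl, hw⟩⟩

theorem IsWeaklyTrim.amalgamate (hβ : IsPOMorphism β) (hY : IsWeaklyTrim Y) :
    IsWeaklyTrim (amalgamate β Y) where
  acc r s h w hw := by
    obtain ⟨p, rfl, hwp⟩ := mem_amalgamate.1 hw
    obtain ⟨q, hq, rfl⟩ := hβ.exists_lt h
    exact derivedSet_mono _ _ (fun x hx => mem_amalgamate.2 ⟨q, rfl, hx⟩) (hY.acc p q hq hwp)
  base w U hU := by
    obtain ⟨A, ⟨p, hA⟩, h⟩ := hY.base w U hU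
    exact ⟨A, ⟨β p, hA.amalgamate hβ⟩, h⟩
  clean r w hw := by
    obtain ⟨p, rfl, hwp⟩ := mem_amalgamate.1 hw
    obtain ⟨A, hA, h⟩ := hY.clean p w hwp
    exact ⟨A, hA.amalgamate hβ, h⟩

end Amalgamation

section Simplicity

variable {P : Type u} [POSystem P] {S : Type v} [POSystem S]

/-- The PO system structure pulled back along an injective map. -/
abbrev POSystem.induced {Q : Type*} (f : Q → S) (hf : Function.Injective f) : POSystem Q where
  lt a b := f a < f b
  trans' := POSystem.trans' (P := S)
  antisymm' h h' := hf (POSystem.antisymm' h h')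

/-- Surjective morphisms from a simple PO system to a PO system in any universe are injective. -/
theorem POSystem.IsSimple.injective_of_surjective (hP : POSystem.IsSimple P) {φ : P → S}
    (hφ : IsPOMorphism φ) (hs : Function.Surjective φ) : Function.Injective φ := by
  let e : Quotient (Setoid.ker φ) ≃ S := Setoid.quotientKerEquivOfSurjective φ hs
  let _ : POSystem (Quotient (Setoid.ker φ)) := POSystem.induced e e.injective
  have he : ∀ p, e (Quotient.mk _ p) = φ p := fun p => rfl
  have hmk : IsPOMorphism (fun p : P => (Quotient.mk (Setoid.ker φ) p)) := by
    intro p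
    ext x
    constructor
    · rintro ⟨q, hq, rfl⟩
      exact hφ.lt hq
    · intro hx
      obtain ⟨q, hq, hqx⟩ := hφ.exists_lt (s := e x) hx
      exact ⟨q, hq, e.injective ((he q).trans hqx)⟩
  intro p q hpq
  exact hP _ _ hmk (Quotient.sound hpq)

/-- A bijective morphism is an isomorphism. -/
noncomputable def IsPOMorphism.toPOIso {φ : P → S} (hφ : IsPOMorphism φ)
    (hb : Function.Bijective φ) : POIso P S where
  toEquiv := Equiv.ofBijective φ hb
  map_rel_iff' := by
    intro p q
    refine ⟨fun h => ?_, fun h => hφ.lt h⟩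
    obtain ⟨r, hr, hrq⟩ := hφ.exists_lt h
    exact hb.1 hrq ▸ hr

theorem POIso.isPOMorphism (θ : POIso P S) : IsPOMorphism θ := by
  intro p
  ext s
  constructor
  · rintro ⟨q, hq, rfl⟩
    exact θ.map_rel_iff.2 hq
  · intro hs
    refine ⟨θ.symm s, θ.map_rel_iff.1 ?_, θ.apply_symm_apply s⟩
    rwa [θ.apply_symm_apply]

theorem IsPOMorphism.comp {R : Type*} [POSystem R] {α : S → R} {φ : P → S}
    (hα : IsPOMorphism α) (hφ : IsPOMorphism φ) : IsPOMorphism (α ∘ φ) := by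
  intro p
  rw [image_comp, hφ p]
  exact hα (φ p)

end Simplicity

section StructureDiagram

/-- An ideal generated by a pair is a product of ideals. -/
def iicProdOrderIso {β γ : Type*} [Preorder β] [Preorder γ] (b : β) (c : γ) :
    Iic (b, c) ≃o Iic b × Iic c where
  toFun x := (⟨x.1.1, x.2.1⟩, ⟨x.1.2, x.2.2⟩)
  invFun x := ⟨(x.1.1, x.2.1), x.1.2, x.2.2⟩
  left_inv _ := rfl
  right_inv _ := rfl
  map_rel_iff' := Iff.rfl

/-- The ideal generated by a pair with first entry `⊥`. -/
def iicBotProdOrderIso {β γ : Type*} [PartialOrder β] [OrderBot β] [Preorder γ] (c : γ) :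
    Iic ((⊥, c) : β × γ) ≃o Iic c where
  toFun x := ⟨x.1.2, x.2.2⟩
  invFun x := ⟨(⊥, x.1), le_rfl, x.2⟩
  left_inv := by
    rintro ⟨⟨x, y⟩, hx, hy⟩
    obtain rfl : x = ⊥ := le_bot_iff.1 hx
    rfl
  right_inv _ := rfl
  map_rel_iff' := by
    rintro ⟨⟨x, y⟩, hx, hy⟩ ⟨⟨x', y'⟩, hx', hy'⟩
    exact ⟨fun h => ⟨le_trans hx bot_le, h⟩, fun h => h.2⟩

/-- A pseudo-indecomposable element below another one has a class that is not smaller. -/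
theorem piClass_Le_of_le {α : Type*} [GeneralizedBooleanAlgebra α] {a b : {a : α // IsPI a}}
    (h : b.1 ≤ a.1) : POSystem.Le (piClass a) (piClass b) := by
  rcases a.2.2 b.1 h with ⟨⟨e⟩⟩ | ⟨⟨e⟩⟩
  · exact Or.inr (Quotient.sound ⟨e.symm⟩)
  · exact Or.inl ⟨(orderIsoProd e.symm (OrderIso.refl _)).trans (iicSdiffProdIicOrderIso h)⟩

theorem exists_le_orderIso_of_piClass_lt {α : Type*} [GeneralizedBooleanAlgebra α]
    {a b : {a : α // IsPI a}} (h : piClass a < piClass b) :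
    ∃ c ≤ a.1, Nonempty (Iic c ≃o Iic b.1) ∧ Nonempty (Iic (a.1 \ c) ≃o Iic a.1) := by
  obtain ⟨e⟩ : Nonempty ((Iic a.1 × Iic b.1) ≃o Iic a.1) := h
  let f : Iic (a.1, b.1) ≃o Iic a.1 := (iicProdOrderIso a.1 b.1).trans e
  let x : Iic (a.1, b.1) := ⟨(⊥, b.1), bot_le, le_rfl⟩
  let y : Iic (a.1, b.1) := ⟨(a.1, b.1) \ x.1, sdiff_le (a := (a.1, b.1))⟩
  have hy : y.1 = (a.1, ⊥) := Prod.ext sdiff_bot (sdiff_self (a := b.1))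
  have hfy : Nonempty (Iic y.1 ≃o Iic (f y).1) := ⟨f.iicRestrict y⟩
  rw [f.iic_map_sdiff x, hy] at hfy
  obtain ⟨g⟩ := hfy
  refine ⟨(f x).1, (f x).2, ⟨(f.iicRestrict x).symm.trans ?_⟩, ⟨g.symm.trans ?_⟩⟩
  · exact iicBotProdOrderIso b.1
  · exact (iicProdOrderIso _ _).trans (OrderIso.prodComm.trans
      ((iicProdOrderIso _ _).symm.trans (iicBotProdOrderIso a.1)))

variable {W : Type u} [TopologicalSpace W] [SecondCountableTopology W] [T2Space W]
  {P : Type v} [POSystem P] {Y : P → Set W}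

theorem IsWeaklyTrim.exists_classMap (hY : IsWeaklyTrim Y) (hne : ∀ p, (Y p).Nonempty) :
    ∃ φ : P → StructureDiagram (CompactOpens W),
      ∀ p A, ∀ hA : IsTrimAt Y A p, φ p = piClass ⟨A, hY.isPI hA⟩ := by
  have hex : ∀ p, ∃ A, IsTrimAt Y A p := fun p => by
    obtain ⟨w, hw⟩ := hne p
    obtain ⟨A, hA, -⟩ := hY.clean p w hw
    exact ⟨A, hA⟩
  choose A hA using hex
  exact ⟨fun p => piClass ⟨A p, hY.isPI (hA p)⟩,
    fun p B hB => Quotient.sound (hY.nonempty_orderIso (hA p) hB)⟩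

variable {φ : P → StructureDiagram (CompactOpens W)}

/-- A pseudo-indecomposable set contains a trim set of its own class. -/
theorem IsWeaklyTrim.exists_isTrimAt_le_of_isPI (hY : IsWeaklyTrim Y)
    (hφ : ∀ p A, ∀ hA : IsTrimAt Y A p, φ p = piClass ⟨A, hY.isPI hA⟩)
    (C : {A : CompactOpens W // IsPI A}) :
    ∃ D ≤ C.1, ∃ p, IsTrimAt Y D p ∧ φ p = piClass C := by
  obtain ⟨D, hD, ⟨p, hp⟩, e⟩ := (hY.isDisjointSum C.1).exists_orderIso_of_isPI C.2
  exact ⟨D, hD, p, hp, (hφ p D hp).trans (Quotient.sound e)⟩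

theorem IsWeaklyTrim.classMap_surjective (hY : IsWeaklyTrim Y)
    (hφ : ∀ p A, ∀ hA : IsTrimAt Y A p, φ p = piClass ⟨A, hY.isPI hA⟩) :
    Function.Surjective φ := by
  rintro ⟨C⟩
  obtain ⟨-, -, p, -, hp⟩ := hY.exists_isTrimAt_le_of_isPI hφ C
  exact ⟨p, hp⟩

theorem IsWeaklyTrim.classMap_isPOMorphism (hY : IsWeaklyTrim Y) (hne : ∀ p, (Y p).Nonempty)
    (hφ : ∀ p A, ∀ hA : IsTrimAt Y A p, φ p = piClass ⟨A, hY.isPI hA⟩) : IsPOMorphism φ := by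
  intro p
  obtain ⟨w, hw⟩ := hne p
  obtain ⟨A, hA, hwA⟩ := hY.clean p w hw
  ext s
  constructor
  · rintro ⟨q, hq, rfl⟩
    obtain ⟨C, hCA, hC, hAC⟩ := hY.exists_isTrimAt_sdiff hA hq
    obtain ⟨e⟩ := hY.nonempty_orderIso hA hAC
    change φ p < φ q
    rw [hφ p A hA, hφ q C hC]
    exact ⟨(orderIsoProd e (OrderIso.refl _)).trans (iicSdiffProdIicOrderIso hCA)⟩
  · intro hs
    change φ p < s at hs
    obtain ⟨⟨B, hB⟩, rfl⟩ : ∃ B, piClass B = s := Quotient.exists_rep s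
    have hs' := hs
    rw [hφ p A hA] at hs'
    obtain ⟨C, hCA, ⟨e⟩, ⟨f⟩⟩ := exists_le_orderIso_of_piClass_lt hs'
    have hLe : ∀ {D : CompactOpens W} {q : P}, D ≤ A → IsTrimAt Y D q → POSystem.Le p q := by
      intro D q hDA hD
      have : q ∈ partType Y A := partType_mono hDA hD.mem_partType
      rwa [hA.1] at this
    obtain ⟨D, hDC, q, hD, hq⟩ := hY.exists_isTrimAt_le_of_isPI hφ ⟨C, hB.of_orderIso e.symm⟩
    have hqB : φ q = piClass ⟨B, hB⟩ := hq.trans (Quotient.sound ⟨e⟩)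
    rcases hLe (hDC.trans hCA) hD with h | rfl
    · exact ⟨q, h, hqB⟩
    · -- `p` itself has the class of `B`; a smaller trim set avoids the point of `C` in `Y p`.
      obtain ⟨D', hD'A, r, hD', hr⟩ := hY.exists_isTrimAt_le_of_isPI hφ
        ⟨A \ C, (hY.isPI hA).of_orderIso f.symm⟩
      have hrB : φ r = piClass ⟨B, hB⟩ :=
        hr.trans ((Quotient.sound (s := isoClassSetoid _)
          (a := ⟨A \ C, _⟩) (b := ⟨A, hY.isPI hA⟩) ⟨f⟩).trans ((hφ p A hA).symm.trans hqB))
      exact ⟨r, hA.lt_of_mem_partType_sdiff hCA (partType_mono hDC hD.mem_partType)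
        (partType_mono hD'A hD'.mem_partType), hrB⟩

/-- The structure diagram is simple with respect to targets in any universe. -/
theorem IsWeaklyTrim.injective_of_isPOMorphism (hY : IsWeaklyTrim Y) (hne : ∀ p, (Y p).Nonempty)
    {R : Type*} [POSystem R] {α : StructureDiagram (CompactOpens W) → R}
    (hα : IsPOMorphism α) : Function.Injective α := by
  obtain ⟨φ, hφ⟩ := hY.exists_classMap hne
  have hβ := hα.comp (hY.classMap_isPOMorphism hne hφ)
  intro x y hxy
  obtain ⟨p, rfl⟩ := hY.classMap_surjective hφ x
  obtain ⟨q, rfl⟩ := hY.classMap_surjective hφ y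
  obtain ⟨v, hv⟩ := hne p
  obtain ⟨w, hw⟩ := hne q
  obtain ⟨A, hA, -⟩ := hY.clean p v hv
  obtain ⟨B, hB, -⟩ := hY.clean q w hw
  have hA' := hA.amalgamate hβ
  have hB' := hB.amalgamate hβ
  rw [← show (α ∘ φ) p = (α ∘ φ) q from hxy] at hB'
  rw [hφ p A hA, hφ q B hB]
  exact Quotient.sound ((hY.amalgamate hβ).nonempty_orderIso hA' hB')

/-- If the class map is injective, the blocks of a trim partition are the canonical ones. -/
theorem IsTrimPartition.eq_canonicalBlock (hY : IsTrimPartition Y)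
    (hφ : ∀ p A, ∀ hA : IsTrimAt Y A p, φ p = piClass ⟨A, hY.isWeaklyTrim.isPI hA⟩)
    (hinj : Function.Injective φ) (p : P) : Y p = canonicalBlock (φ p) := by
  apply Subset.antisymm
  · intro w hw U hU
    obtain ⟨A, hA, hwA, hAU⟩ := hY.isWeaklyTrim.exists_isTrimAt_subset hw hU
    exact ⟨⟨A, hY.isWeaklyTrim.isPI hA⟩, (hφ p A hA).symm, hwA, hAU⟩
  · intro w hw
    obtain ⟨v, hv⟩ := hY.nonempty p
    obtain ⟨A₀, hA₀, -⟩ := hY.clean p v hv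
    refine hY.full p ⟨A₀, hA₀⟩ w fun U hU => ?_
    obtain ⟨A, hA, hwA, hAU⟩ := hw U hU
    obtain ⟨B, ⟨q, hB⟩, hwB, hBA⟩ := hY.base w A.1 (A.1.isOpen.mem_nhds hwA)
    obtain ⟨C, hC, hwC, hCB⟩ := hw B (B.isOpen.mem_nhds hwB)
    have h1 := piClass_Le_of_le (a := A) (b := ⟨B, hY.isWeaklyTrim.isPI hB⟩) hBA
    have h2 := piClass_Le_of_le (a := ⟨B, hY.isWeaklyTrim.isPI hB⟩) (b := C) hCB
    rw [hA, ← hφ q B hB] at h1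
    rw [hC, ← hφ q B hB] at h2
    obtain rfl := hinj (h1.antisymm h2)
    exact ⟨B, hB, hwB, hBA.trans hAU⟩

end StructureDiagram

/-- For a trim `P`-partition `Y` of an `ω`-Stone space `W`, the space `W` is primitive, and the
following are equivalent: `Y` is the canonical partition up to relabelling; `P` is isomorphic to
the structure diagram of `W`; `P` is simple. -/
theorem trim_partition_canonical_tfae {W : Type u} {P : Type v}
    [TopologicalSpace W] [SecondCountableTopology W] [LocallyCompactSpace W]
    [T2Space W] [TotallyDisconnectedSpace W]
    [POSystem P] [Countable P] (Y : P → Set W) (hY : IsTrimPartition Y) :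
    IsPrimitiveRing (CompactOpens W) ∧
    List.TFAE [
      ∃ θ : POIso P (StructureDiagram (CompactOpens W)), ∀ p, Y p = canonicalBlock (θ p),
      Nonempty (POIso P (StructureDiagram (CompactOpens W))),
      POSystem.IsSimple P] := by
  have hW := hY.isWeaklyTrim
  refine ⟨fun A => (hW.isDisjointSum A).exists_finset fun B ⟨p, hB⟩ => hW.isPI hB, ?_⟩
  tfae_have 1 → 2 := fun ⟨θ, _⟩ => ⟨θ⟩
  tfae_have 2 → 3 := by
    rintro ⟨θ⟩ R _ α hα p q hpq
    have h := hW.injective_of_isPOMorphism hY.nonempty (hα.comp (POIso.isPOMorphism θ.symm))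
    refine θ.injective (h ?_)
    simpa using hpq
  tfae_have 3 → 1 := by
    intro hP
    obtain ⟨φ, hφ⟩ := hW.exists_classMap hY.nonempty
    have hm := hW.classMap_isPOMorphism hY.nonempty hφ
    have hs := hW.classMap_surjective hφ
    have hi := hP.injective_of_surjective hm hs
    exact ⟨hm.toPOIso ⟨hi, hs⟩, hY.eq_canonicalBlock hφ hi⟩
  tfae_finish
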